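/- arXiv:math/0208243 — 7 statements merged into one kernel-verified Lean document; each statement's English description precedes it below -/
import Mathlib

section
/- Let d ≥ 1, let E := EuclideanSpace ℝ (Fin d), and let X ⊆ E be an (r,R)-Delone set. Then for every y ∈ X, the closure of the Voronoi cell of y is exactly the set of points whose distance to y is minimal among points of X: closure V_y = {z ∈ E | ∀ x ∈ X, dist z y ≤ dist z x}. -/
noncomputable section

/-- The Euclidean space `ℝ^d`. -/
abbrev Ee (d : ℕ) := EuclideanSpace ℝ (Fin d)

/-- `X` is an `(r, R)`-Delone set in `ℝ^d`: every open ball of radius `r` contains at most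
one point of `X`, and every open ball of radius `R` contains at least one point of `X`. -/
def IsDelone {d : ℕ} (r R : ℝ) (X : Set (Ee d)) : Prop :=
  (∀ z : Ee d, (X ∩ Metric.ball z r).Subsingleton) ∧
    (∀ z : Ee d, (X ∩ Metric.ball z R).Nonempty)

/-- The (open) Voronoi cell of a point `y` of a Delone set `X`: the points strictly closer
to `y` than to any other point of `X`. -/
def voronoiCell {d : ℕ} (X : Set (Ee d)) (y : Ee d) : Set (Ee d) :=
  {z : Ee d | ∀ x ∈ X, x ≠ y → dist z y < dist z x}

/-- If `z` is at least as close to `y` as to `x ≠ y`, every point of the open segment from `y`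
to `z` is strictly closer to `y` than to `x`. -/
theorem dist_lt_dist_of_mem_openSegment {V : Type*} [NormedAddCommGroup V]
    [InnerProductSpace ℝ V] {x y z w : V} (hxy : x ≠ y) (hz : dist z y ≤ dist z x)
    (hw : w ∈ openSegment ℝ y z) : dist w y < dist w x := by
  obtain ⟨a, b, ha, hb, hab, rfl⟩ := hw
  obtain rfl : b = 1 - a := by linarith
  have hu : 0 < ‖y - x‖ ^ 2 := by
    have : 0 < ‖y - x‖ := norm_pos_iff.mpr (sub_ne_zero.mpr hxy.symm)
    positivity
  rw [dist_eq_norm, dist_eq_norm] at hz ⊢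
  have hzy : ‖(z - x) - (y - x)‖ ^ 2 ≤ ‖z - x‖ ^ 2 := by
    rw [sub_sub_sub_cancel_right]
    gcongr
  have ey : a • y + (1 - a) • z - y = (1 - a) • ((z - x) - (y - x)) := by module
  have ex : a • y + (1 - a) • z - x = a • (y - x) + (1 - a) • (z - x) := by module
  refine lt_of_pow_lt_pow_left₀ 2 (norm_nonneg _) ?_
  rw [ey, ex, norm_smul, mul_pow, Real.norm_eq_abs, sq_abs, norm_add_sq_real, norm_smul,
    norm_smul, mul_pow, mul_pow, Real.norm_eq_abs, Real.norm_eq_abs, sq_abs, sq_abs,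
    real_inner_smul_left, real_inner_smul_right, real_inner_comm]
  rw [norm_sub_sq_real] at hzy ⊢
  nlinarith [mul_pos ha hu, mul_le_mul_of_nonneg_left hzy hb.le]

/-- For an `(r,R)`-Delone set `X` in `ℝ^d` and `y ∈ X`, the closure of the
Voronoi cell of `y` is exactly the set of points whose distance to `y` is minimal among
points of `X`. -/
theorem closure_voronoiCell_eq
    (d : ℕ) (hd : 1 ≤ d) (r R : ℝ) (hr : 0 < r) (hR : 0 < R)
    (X : Set (Ee d)) (hX : IsDelone r R X) (y : Ee d) (hy : y ∈ X) :
    closure (voronoiCell X y) = {z : Ee d | ∀ x ∈ X, dist z y ≤ dist z x} := by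
  apply subset_antisymm
  · have hclosed : IsClosed {z : Ee d | ∀ x ∈ X, dist z y ≤ dist z x} := by
      simp only [Set.ofPred_forall]
      exact isClosed_biInter fun x _ => isClosed_le (by fun_prop) (by fun_prop)
    refine closure_minimal (fun z hz x hx => ?_) hclosed
    rcases eq_or_ne x y with rfl | hxy
    · exact le_rfl
    · exact (hz x hx hxy).le
  · intro z hz
    have hsub : openSegment ℝ y z ⊆ voronoiCell X y := fun w hw x hx hxy =>
      dist_lt_dist_of_mem_openSegment hxy (hz x hx) hw
    apply closure_mono hsub
    rw [closure_openSegment]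
    exact right_mem_segment ℝ y z
end
end

section
/- Let d ≥ 1, let E := EuclideanSpace ℝ (Fin d), and let X ⊆ E be an (r,R)-Delone set of finite local complexity. Then there are only finitely many Voronoi cells of X up to translation: the set {(closure V_y) − y | y ∈ X} of translated closed Voronoi cells is finite (where S − y := {p − y | p ∈ S}). -/
noncomputable section

/-- The setTranslate `S − x = {p − x | p ∈ S}` of a subset `S` of `ℝ^d`. -/
def setTranslate {d : ℕ} (S : Set (Ee d)) (x : Ee d) : Set (Ee d) :=
  (fun p => p - x) '' S

/-- `X` has finite local complexity (finite `ℝ^d`-type): for every `ρ > 0` there are only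
finitely many translated patches `(X − x) ∩ Metric.closedBall 0 ρ` with `x ∈ X`. -/
def HasFLC {d : ℕ} (X : Set (Ee d)) : Prop :=
  ∀ ρ : ℝ, 0 < ρ →
    {P : Set (Ee d) | ∃ x ∈ X, P = setTranslate X x ∩ Metric.closedBall 0 ρ}.Finite

/-- Translation by `-y` carries the Voronoi cell of `y` to the Voronoi cell of the origin. -/
theorem setTranslate_voronoiCell {d : ℕ} (X : Set (Ee d)) (y : Ee d) :
    setTranslate (voronoiCell X y) y = voronoiCell (setTranslate X y) 0 := by
  ext z
  constructor
  · rintro ⟨p, hp, rfl⟩ _ ⟨x, hx, rfl⟩ hne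
    have h := hp x hx (fun h => hne (by simp [h]))
    simpa [dist_eq_norm] using h
  · intro hz
    refine ⟨z + y, fun x hx hne => ?_, by simp⟩
    have h := hz (x - y) ⟨x, hx, rfl⟩ (sub_ne_zero.mpr hne)
    rw [dist_eq_norm, dist_eq_norm] at h ⊢
    convert h using 2 <;> abel

theorem setTranslate_closure {d : ℕ} (S : Set (Ee d)) (y : Ee d) :
    setTranslate (closure S) y = closure (setTranslate S y) :=
  (Homeomorph.subRight y).image_closure S

/-- The Voronoi cell of the origin depends only on the points at distance at most `2 * R`,
provided every open ball of radius `R` meets the set. -/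
theorem voronoiCell_zero_eq_inter_closedBall {d : ℕ} {R : ℝ} (hR : 0 < R) {Y : Set (Ee d)}
    (hY : ∀ z : Ee d, (Y ∩ Metric.ball z R).Nonempty) :
    voronoiCell Y 0 = voronoiCell (Y ∩ Metric.closedBall 0 (2 * R)) 0 := by
  refine Set.Subset.antisymm (fun z hz x hx => hz x hx.1) fun z hz x hx hne => ?_
  have hzR : ‖z‖ < R := by
    by_contra! hRz
    have hz0 : 0 < ‖z‖ := hR.trans_le hRz
    set w : Ee d := (R / ‖z‖) • z with hw
    have hwn : ‖w‖ = R := by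
      rw [hw, norm_smul, Real.norm_of_nonneg (by positivity), div_mul_cancel₀ _ hz0.ne']
    have hzw : dist z w = ‖z‖ - R := by
      have : z - w = (1 - R / ‖z‖) • z := by rw [hw, sub_smul, one_smul]
      rw [dist_eq_norm, this, norm_smul, Real.norm_of_nonneg
        (sub_nonneg.mpr ((div_le_one hz0).mpr hRz)), sub_mul, div_mul_cancel₀ _ hz0.ne', one_mul]
    obtain ⟨u, huY, hu⟩ := hY w
    rw [Metric.mem_ball] at hu
    have hu0 : u ≠ 0 := by
      rintro rfl
      rw [dist_zero_left, hwn] at hu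
      exact hu.false
    have hu2 : u ∈ Metric.closedBall (0 : Ee d) (2 * R) := by
      have h := dist_triangle u w 0
      rw [dist_zero_right w, hwn] at h
      rw [Metric.mem_closedBall]
      linarith
    have h := hz u ⟨huY, hu2⟩ hu0
    have h' := dist_triangle z w u
    rw [dist_zero_right] at h
    rw [dist_comm w u] at h'
    linarith
  by_cases hx2 : x ∈ Metric.closedBall (0 : Ee d) (2 * R)
  · exact hz x ⟨hx, hx2⟩ hne
  · rw [mem_closedBall_zero_iff, not_le] at hx2
    have h := norm_sub_norm_le x z
    rw [dist_zero_right, dist_comm, dist_eq_norm]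
    linarith

theorem setTranslate_inter_ball_nonempty {d : ℕ} {R : ℝ} {X : Set (Ee d)}
    (hX : ∀ z : Ee d, (X ∩ Metric.ball z R).Nonempty) (y z : Ee d) :
    (setTranslate X y ∩ Metric.ball z R).Nonempty := by
  obtain ⟨x, hx, hxz⟩ := hX (z + y)
  refine ⟨x - y, ⟨x, hx, rfl⟩, ?_⟩
  rw [Metric.mem_ball, dist_eq_norm] at hxz ⊢
  rwa [sub_sub, add_comm y z]

/-- For an `(r,R)`-Delone set `X` in `ℝ^d` of finite local complexity,
there are only finitely many closed Voronoi cells of `X` up to translation. -/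
theorem finite_voronoiCells_up_to_translation
    (d : ℕ) (hd : 1 ≤ d) (r R : ℝ) (hr : 0 < r) (hR : 0 < R)
    (X : Set (Ee d)) (hX : IsDelone r R X) (hFLC : HasFLC X) :
    {S : Set (Ee d) | ∃ y ∈ X, S = setTranslate (closure (voronoiCell X y)) y}.Finite := by
  refine ((hFLC (2 * R) (by positivity)).image fun P => closure (voronoiCell P 0)).subset ?_
  rintro _ ⟨y, hy, rfl⟩
  refine ⟨_, ⟨y, hy, rfl⟩, ?_⟩
  rw [setTranslate_closure, setTranslate_voronoiCell]
  exact congrArg closure (voronoiCell_zero_eq_inter_closedBall hR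
    (setTranslate_inter_ball_nonempty hX.2 y)).symm
end
end

section
/- Let d ≥ 1, let E := EuclideanSpace ℝ (Fin d), and let X ⊆ E be an (r,R)-Delone set of finite local complexity. Then the canonical transversal T, equipped with the patch topology, is a compact topological space. -/
noncomputable section

/-- The local-isomorphism hull of `Z ⊆ ℝ^d`: the sets `Y` all of whose patches appear,
up to translation, as patches of `Z`. -/
def hull {d : ℕ} (Z : Set (Ee d)) : Set (Set (Ee d)) :=
  {Y : Set (Ee d) | ∀ z : Ee d, ∀ ρ : ℝ, 0 < ρ → ∃ w : Ee d,
    setTranslate Y z ∩ Metric.closedBall 0 ρ = setTranslate Z w ∩ Metric.closedBall 0 ρ}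

/-- The canonical transversal of `X`: the elements of the hull of `X` containing `0`. -/
def Transversal {d : ℕ} (X : Set (Ee d)) : Type :=
  {Y : Set (Ee d) // Y ∈ hull X ∧ (0 : Ee d) ∈ Y}

/-- The patch topology on the canonical transversal, generated by the sets
`U(ρ, P) = {Y | Y ∩ Metric.closedBall 0 ρ = P}` for `ρ > 0` and `P ⊆ ℝ^d`. -/
instance patchTopology {d : ℕ} (X : Set (Ee d)) : TopologicalSpace (Transversal X) :=
  TopologicalSpace.generateFrom
    {U : Set (Transversal X) | ∃ ρ : ℝ, 0 < ρ ∧ ∃ P : Set (Ee d),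
      U = {Y : Transversal X | Y.1 ∩ Metric.closedBall 0 ρ = P}}

theorem mem_setTranslate_iff {d : ℕ} {S : Set (Ee d)} {x p : Ee d} :
    p ∈ setTranslate S x ↔ p + x ∈ S := by
  constructor
  · rintro ⟨q, hq, rfl⟩
    simpa using hq
  · intro h
    exact ⟨p + x, h, by simp⟩

theorem setTranslate_zero {d : ℕ} (S : Set (Ee d)) : setTranslate S 0 = S := by
  ext p
  simp [mem_setTranslate_iff]

/-- Agreement of two sets on a large centered ball gives agreement of their translates. -/
theorem setTranslate_inter_closedBall_congr {d : ℕ} {S S' : Set (Ee d)} {z : Ee d} {ρ : ℝ}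
    (h : S ∩ Metric.closedBall 0 (ρ + ‖z‖) = S' ∩ Metric.closedBall 0 (ρ + ‖z‖)) :
    setTranslate S z ∩ Metric.closedBall 0 ρ = setTranslate S' z ∩ Metric.closedBall 0 ρ := by
  ext p
  simp only [Set.mem_inter_iff, mem_setTranslate_iff, mem_closedBall_zero_iff]
  refine and_congr_left fun hp => ?_
  have hpz : p + z ∈ Metric.closedBall (0 : Ee d) (ρ + ‖z‖) := by
    rw [mem_closedBall_zero_iff]
    exact (norm_add_le p z).trans (by gcongr)
  simpa [hpz] using Set.ext_iff.mp h (p + z)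

/-- Only finitely many centered patches of radius `ρ` occur in the transversal. -/
theorem HasFLC.finite_range_inter_closedBall {d : ℕ} {X : Set (Ee d)} (hX : HasFLC X)
    {ρ : ℝ} (hρ : 0 < ρ) :
    (Set.range fun Y : Transversal X => Y.1 ∩ Metric.closedBall 0 ρ).Finite := by
  refine (hX ρ hρ).subset ?_
  rintro _ ⟨Y, rfl⟩
  obtain ⟨w, hw⟩ := Y.2.1 0 ρ hρ
  rw [setTranslate_zero] at hw
  have h0 : (0 : Ee d) ∈ setTranslate X w ∩ Metric.closedBall 0 ρ :=
    hw ▸ ⟨Y.2.2, Metric.mem_closedBall_self hρ.le⟩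
  exact ⟨w, by simpa using mem_setTranslate_iff.mp h0.1, hw⟩

/-- The set of points eventually belonging to the members of an ultrafilter on the transversal. -/
def ultrafilterLimit {d : ℕ} {X : Set (Ee d)} (F : Ultrafilter (Transversal X)) : Set (Ee d) :=
  {p | ∀ᶠ Z : Transversal X in (F : Filter (Transversal X)), p ∈ Z.1}

theorem HasFLC.eventually_inter_closedBall_eq {d : ℕ} {X : Set (Ee d)} (hX : HasFLC X)
    (F : Ultrafilter (Transversal X)) {ρ : ℝ} (hρ : 0 < ρ) :
    ∀ᶠ Z : Transversal X in (F : Filter (Transversal X)),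
      Z.1 ∩ Metric.closedBall 0 ρ = ultrafilterLimit F ∩ Metric.closedBall 0 ρ := by
  obtain ⟨P, -, hP⟩ := (Ultrafilter.eventually_exists_mem_iff (f := F)
    (P := fun P Z => Z.1 ∩ Metric.closedBall 0 ρ = P)
    (hX.finite_range_inter_closedBall hρ)).mp
    (Filter.Eventually.of_forall fun Z => ⟨_, ⟨Z, rfl⟩, rfl⟩)
  suffices h : ultrafilterLimit F ∩ Metric.closedBall 0 ρ = P by rwa [h]
  ext p
  constructor
  · rintro ⟨hp, hpρ⟩
    obtain ⟨Z, hZ, hpZ⟩ := (Filter.Eventually.and hP hp).exists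
    exact hZ ▸ ⟨hpZ, hpρ⟩
  · intro hp
    have h : ∀ᶠ Z : Transversal X in (F : Filter (Transversal X)),
        p ∈ Z.1 ∩ Metric.closedBall 0 ρ :=
      hP.mono fun Z hZ => hZ.symm ▸ hp
    exact ⟨h.mono fun Z hZ => hZ.1, h.exists.choose_spec.2⟩

theorem HasFLC.ultrafilterLimit_mem_hull {d : ℕ} {X : Set (Ee d)} (hX : HasFLC X)
    (F : Ultrafilter (Transversal X)) : ultrafilterLimit F ∈ hull X := by
  intro z ρ hρ
  obtain ⟨Z, hZ⟩ := (hX.eventually_inter_closedBall_eq F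
    (show 0 < ρ + ‖z‖ by positivity)).exists
  obtain ⟨w, hw⟩ := Z.2.1 z ρ hρ
  exact ⟨w, (setTranslate_inter_closedBall_congr hZ).symm.trans hw⟩

/-- For an `(r,R)`-Delone set `X` in `ℝ^d` of finite local complexity, the
canonical transversal with the patch topology is compact. -/
theorem transversal_compact
    (d : ℕ) (hd : 1 ≤ d) (r R : ℝ) (hr : 0 < r) (hR : 0 < R)
    (X : Set (Ee d)) (hX : IsDelone r R X) (hFLC : HasFLC X) :
    CompactSpace (Transversal X) := by
  refine ⟨isCompact_iff_ultrafilter_le_nhds.mpr fun F _ => ?_⟩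
  refine ⟨⟨ultrafilterLimit F, hFLC.ultrafilterLimit_mem_hull F,
    Filter.Eventually.of_forall fun Z : Transversal X => Z.2.2⟩, Set.mem_univ _, ?_⟩
  refine Filter.tendsto_id'.mp (TopologicalSpace.tendsto_nhds_generateFrom_iff.mpr ?_)
  rintro _ ⟨ρ, hρ, P, rfl⟩ hP
  exact (hFLC.eventually_inter_closedBall_eq F hρ).mono fun Z hZ => hZ.trans hP
end
end

section
/- Let N ≥ 1, let C ≥ 1 be a real number, and let A be an N×N real matrix all of whose entries lie in the interval [1, C]. Let x, y : Fin N → ℝ be vectors with all coordinates nonnegative and neither x nor y identically zero. Then A.mulVec x and A.mulVec y have all coordinates strictly positive, and d_H(A.mulVec x, A.mulVec y) ≤ 2 * Real.log C. -/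
noncomputable section

/-- The Hilbert projective distance between two vectors with strictly positive
coordinates: `d_H(u, w) = log ((⨆ i, u i / w i) * (⨆ i, w i / u i))`. -/
def hilbertDist {N : ℕ} (u w : Fin N → ℝ) : ℝ :=
  Real.log ((⨆ i, u i / w i) * (⨆ i, w i / u i))

theorem mulVec_mem_Icc_of_entries_mem_Icc {m n : Type*} [Fintype n] {a b : ℝ}
    {A : Matrix m n ℝ} (hA : ∀ i j, A i j ∈ Set.Icc a b) {x : n → ℝ} (hx : ∀ j, 0 ≤ x j)
    (i : m) : A.mulVec x i ∈ Set.Icc (a * ∑ j, x j) (b * ∑ j, x j) := by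
  rw [Finset.mul_sum, Finset.mul_sum]
  exact ⟨Finset.sum_le_sum fun j _ => mul_le_mul_of_nonneg_right (hA i j).1 (hx j),
    Finset.sum_le_sum fun j _ => mul_le_mul_of_nonneg_right (hA i j).2 (hx j)⟩

theorem sum_pos_of_nonneg_of_ne_zero {n : Type*} [Fintype n] {x : n → ℝ}
    (hx : ∀ j, 0 ≤ x j) (hx0 : x ≠ 0) : 0 < ∑ j, x j :=
  Fintype.sum_pos (lt_of_le_of_ne hx hx0.symm)

theorem iSup_div_pos {N : ℕ} [Nonempty (Fin N)] {u w : Fin N → ℝ}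
    (hu : ∀ i, 0 < u i) (hw : ∀ i, 0 < w i) : 0 < ⨆ i, u i / w i :=
  let i := Classical.arbitrary (Fin N)
  (div_pos (hu i) (hw i)).trans_le
    (le_ciSup (f := fun i => u i / w i) (Set.finite_range _).bddAbove i)

/-- If all entries of `A` lie in `[1, C]` (with `C ≥ 1`) and `x`, `y` are
nonzero vectors with nonnegative coordinates, then `A.mulVec x` and `A.mulVec y` have
strictly positive coordinates and `d_H(A.mulVec x, A.mulVec y) ≤ 2 * log C`. -/
theorem hilbertDist_mulVec_le_of_entries_mem_Icc
    (N : ℕ) (hN : 1 ≤ N) (C : ℝ) (hC : 1 ≤ C)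
    (A : Matrix (Fin N) (Fin N) ℝ) (hA : ∀ i j, A i j ∈ Set.Icc (1 : ℝ) C)
    (x y : Fin N → ℝ) (hx : ∀ i, 0 ≤ x i) (hy : ∀ i, 0 ≤ y i)
    (hx0 : x ≠ 0) (hy0 : y ≠ 0) :
    (∀ i, 0 < A.mulVec x i) ∧ (∀ i, 0 < A.mulVec y i) ∧
      hilbertDist (A.mulVec x) (A.mulVec y) ≤ 2 * Real.log C := by
  have : Nonempty (Fin N) := ⟨⟨0, hN⟩⟩
  have hs := sum_pos_of_nonneg_of_ne_zero hx hx0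
  have ht := sum_pos_of_nonneg_of_ne_zero hy hy0
  have hu := mulVec_mem_Icc_of_entries_mem_Icc hA hx
  have hw := mulVec_mem_Icc_of_entries_mem_Icc hA hy
  simp only [one_mul, Set.mem_Icc] at hu hw
  have hu0 : ∀ i, 0 < A.mulVec x i := fun i => hs.trans_le (hu i).1
  have hw0 : ∀ i, 0 < A.mulVec y i := fun i => ht.trans_le (hw i).1
  refine ⟨hu0, hw0, ?_⟩
  have hxy : ⨆ i, A.mulVec x i / A.mulVec y i ≤ C * (∑ j, x j) / ∑ j, y j :=
    ciSup_le fun i => div_le_div₀ (by positivity) (hu i).2 ht (hw i).1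
  have hyx : ⨆ i, A.mulVec y i / A.mulVec x i ≤ C * (∑ j, y j) / ∑ j, x j :=
    ciSup_le fun i => div_le_div₀ (by positivity) (hw i).2 hs (hu i).1
  have hxy0 := iSup_div_pos hu0 hw0
  have hyx0 := iSup_div_pos hw0 hu0
  calc hilbertDist (A.mulVec x) (A.mulVec y)
      ≤ Real.log (C * (∑ j, x j) / (∑ j, y j) * (C * (∑ j, y j) / ∑ j, x j)) :=
        Real.log_le_log (mul_pos hxy0 hyx0) (mul_le_mul hxy hyx hyx0.le (hxy0.le.trans hxy))
    _ = Real.log (C ^ 2) := by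
        congr 1
        field_simp
    _ = 2 * Real.log C := by
        rw [Real.log_pow, Nat.cast_ofNat]
end
end

section
/- Let N ≥ 1 and let A be an N×N real matrix all of whose entries are strictly positive. Then for all vectors x, y : Fin N → ℝ with all coordinates strictly positive, the vectors A.mulVec x and A.mulVec y have all coordinates strictly positive and d_H(A.mulVec x, A.mulVec y) ≤ d_H(x, y); that is, A is non-expansive for the Hilbert projective distance on the positive cone. -/
noncomputable section

theorem Matrix.mulVec_pos_of_pos {m n R : Type*} [Fintype n] [Nonempty n]
    [Semiring R] [PartialOrder R] [IsStrictOrderedRing R]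
    {A : Matrix m n R} (hA : ∀ i j, 0 < A i j) {x : n → R} (hx : ∀ j, 0 < x j) (i : m) :
    0 < A.mulVec x i :=
  Finset.sum_pos (fun j _ => mul_pos (hA i j) (hx j)) Finset.univ_nonempty

/-- The maximal coordinate ratio does not increase under a matrix with positive entries. -/
theorem Matrix.iSup_mulVec_div_mulVec_le {m n : Type*} [Fintype n] [Nonempty m] [Nonempty n]
    {A : Matrix m n ℝ} (hA : ∀ i j, 0 < A i j) (x : n → ℝ) {y : n → ℝ} (hy : ∀ j, 0 < y j) :
    ⨆ i, A.mulVec x i / A.mulVec y i ≤ ⨆ j, x j / y j := by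
  refine ciSup_le fun i => ?_
  rw [div_le_iff₀ (Matrix.mulVec_pos_of_pos hA hy i)]
  simp only [Matrix.mulVec, dotProduct, Finset.mul_sum]
  refine Finset.sum_le_sum fun j _ => ?_
  have h : x j ≤ (⨆ k, x k / y k) * y j :=
    (div_le_iff₀ (hy j)).1 (le_ciSup (f := fun k => x k / y k) (Set.finite_range _).bddAbove j)
  calc A i j * x j ≤ A i j * ((⨆ k, x k / y k) * y j) :=
        mul_le_mul_of_nonneg_left h (hA i j).le
    _ = (⨆ k, x k / y k) * (A i j * y j) := by ring

theorem iSup_div_pos_s14 {ι : Type*} [Finite ι] [Nonempty ι] {x y : ι → ℝ}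
    (hx : ∀ i, 0 < x i) (hy : ∀ i, 0 < y i) : 0 < ⨆ i, x i / y i :=
  let i := Classical.arbitrary ι
  (div_pos (hx i) (hy i)).trans_le
    (le_ciSup (f := fun k => x k / y k) (Set.finite_range _).bddAbove i)

/-- A matrix with strictly positive entries is non-expansive for the
Hilbert projective distance on the (strictly) positive cone. -/
theorem hilbertDist_mulVec_le
    (N : ℕ) (hN : 1 ≤ N)
    (A : Matrix (Fin N) (Fin N) ℝ) (hA : ∀ i j, 0 < A i j) :
    ∀ x y : Fin N → ℝ, (∀ i, 0 < x i) → (∀ i, 0 < y i) →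
      (∀ i, 0 < A.mulVec x i) ∧ (∀ i, 0 < A.mulVec y i) ∧
        hilbertDist (A.mulVec x) (A.mulVec y) ≤ hilbertDist x y := by
  have : Nonempty (Fin N) := ⟨⟨0, hN⟩⟩
  intro x y hx hy
  have hAx := Matrix.mulVec_pos_of_pos hA hx
  have hAy := Matrix.mulVec_pos_of_pos hA hy
  refine ⟨hAx, hAy, Real.log_le_log (mul_pos (iSup_div_pos_s14 hAx hAy) (iSup_div_pos_s14 hAy hAx)) ?_⟩
  exact mul_le_mul (Matrix.iSup_mulVec_div_mulVec_le hA x hy)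
    (Matrix.iSup_mulVec_div_mulVec_le hA y hx) (iSup_div_pos_s14 hAy hAx).le (iSup_div_pos_s14 hx hy).le
end
end

section
/- For every real C ≥ 1 there exists λ ∈ [0,1) (depending only on C) such that for every N ≥ 1, every N×N real matrix A with all entries in [1, C], and all vectors x, y : Fin N → ℝ with all coordinates strictly positive, one has d_H(A.mulVec x, A.mulVec y) ≤ λ * d_H(x, y). (Uniform contraction of the Hilbert projective distance by matrices with uniformly bounded positive entries.) -/
noncomputable section

/-- A positive matrix-vector product is comparable to the total mass of the vector. -/
lemma sum_le_mulVec_le {N : ℕ} {C : ℝ} {A : Matrix (Fin N) (Fin N) ℝ}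
    (hA : ∀ i j, A i j ∈ Set.Icc (1 : ℝ) C) {z : Fin N → ℝ} (hz : ∀ j, 0 ≤ z j) (i : Fin N) :
    ∑ j, z j ≤ A.mulVec z i ∧ A.mulVec z i ≤ C * ∑ j, z j := by
  simp only [Matrix.mulVec, dotProduct, Finset.mul_sum]
  exact ⟨Finset.sum_le_sum fun j _ => le_mul_of_one_le_left (hz j) (hA i j).1,
    Finset.sum_le_sum fun j _ => mul_le_mul_of_nonneg_right (hA i j).2 (hz j)⟩

lemma sum_pos_of_index {N : ℕ} {y : Fin N → ℝ} (hy : ∀ j, 0 < y j) (i : Fin N) :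
    0 < ∑ j, y j :=
  Finset.sum_pos (fun j _ => hy j) ⟨i, Finset.mem_univ i⟩

/-- If `a • y ≤ x`, then the coordinatewise ratios of `A x` and `A y` cannot spread arbitrarily:
each ratio lies above a fixed convex combination of any other ratio and `a`. -/
lemma convex_comb_le_mulVec_div {N : ℕ} {C : ℝ} (hC : 1 ≤ C) {A : Matrix (Fin N) (Fin N) ℝ}
    (hA : ∀ i j, A i j ∈ Set.Icc (1 : ℝ) C) {x y : Fin N → ℝ} (hy : ∀ j, 0 < y j) {a : ℝ}
    (ha : ∀ j, a * y j ≤ x j) (i k : Fin N) :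
    (C ^ 2)⁻¹ * (A.mulVec x i / A.mulVec y i) + (1 - (C ^ 2)⁻¹) * a ≤
      A.mulVec x k / A.mulVec y k := by
  have hC0 : 0 < C := by linarith
  set z : Fin N → ℝ := x - a • y with hz
  have hz0 : ∀ j, 0 ≤ z j := fun j => by simpa [hz] using ha j
  have hsy := sum_pos_of_index hy i
  have hsz : 0 ≤ ∑ j, z j := Finset.sum_nonneg fun j _ => hz0 j
  have hratio : ∀ l, A.mulVec x l / A.mulVec y l = a + A.mulVec z l / A.mulVec y l := by
    intro l
    have hl : 0 < A.mulVec y l := hsy.trans_le (sum_le_mulVec_le hA (fun j => (hy j).le) l).1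
    have : A.mulVec z l = A.mulVec x l - a * A.mulVec y l := by
      simp [hz, Matrix.mulVec_sub, Matrix.mulVec_smul]
    rw [this]
    field_simp
    ring
  have hupper : A.mulVec z i / A.mulVec y i ≤ C * (∑ j, z j) / ∑ j, y j :=
    div_le_div₀ (by positivity) (sum_le_mulVec_le hA hz0 i).2 hsy
      (sum_le_mulVec_le hA (fun j => (hy j).le) i).1
  have hky := sum_le_mulVec_le hA (fun j => (hy j).le) k
  have hlower : (∑ j, z j) / (C * ∑ j, y j) ≤ A.mulVec z k / A.mulVec y k :=
    div_le_div₀ (hsz.trans (sum_le_mulVec_le hA hz0 k).1) (sum_le_mulVec_le hA hz0 k).1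
      (hsy.trans_le hky.1) hky.2
  have hcompare : (C ^ 2)⁻¹ * (A.mulVec z i / A.mulVec y i) ≤ A.mulVec z k / A.mulVec y k :=
    calc (C ^ 2)⁻¹ * (A.mulVec z i / A.mulVec y i)
        ≤ (C ^ 2)⁻¹ * (C * (∑ j, z j) / ∑ j, y j) := by gcongr
      _ = (∑ j, z j) / (C * ∑ j, y j) := by field_simp
      _ ≤ _ := hlower
  rw [hratio i, hratio k]
  linarith

/-- Uniform contraction of the Hilbert projective distance: for every
`C ≥ 1` there is `λ ∈ [0, 1)`, depending only on `C`, such that every square matrix (of any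
size `N ≥ 1`) with all entries in `[1, C]` contracts the Hilbert projective distance on the
positive cone by the factor `λ`. -/
theorem exists_uniform_hilbert_contraction
    (C : ℝ) (hC : 1 ≤ C) :
    ∃ lam : ℝ, lam ∈ Set.Ico (0 : ℝ) 1 ∧
      ∀ N : ℕ, 1 ≤ N → ∀ A : Matrix (Fin N) (Fin N) ℝ,
        (∀ i j, A i j ∈ Set.Icc (1 : ℝ) C) →
        ∀ x y : Fin N → ℝ, (∀ i, 0 < x i) → (∀ i, 0 < y i) →
          hilbertDist (A.mulVec x) (A.mulVec y) ≤ lam * hilbertDist x y := by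
  have hδ0 : 0 < (C ^ 2)⁻¹ := by positivity
  have hδ1 : (C ^ 2)⁻¹ ≤ 1 := inv_le_one_of_one_le₀ (one_le_pow₀ hC)
  refine ⟨1 - (C ^ 2)⁻¹, ⟨by linarith, by linarith⟩, ?_⟩
  intro N hN A hA x y hx hy
  have : Nonempty (Fin N) := ⟨⟨0, hN⟩⟩
  have hAx : ∀ l, 0 < A.mulVec x l := fun l =>
    (sum_pos_of_index hx l).trans_le (sum_le_mulVec_le hA (fun j => (hx j).le) l).1
  have hAy : ∀ l, 0 < A.mulVec y l := fun l =>
    (sum_pos_of_index hy l).trans_le (sum_le_mulVec_le hA (fun j => (hy j).le) l).1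
  obtain ⟨i, hi⟩ := exists_eq_ciSup_of_finite (f := fun l => A.mulVec x l / A.mulVec y l)
  obtain ⟨k, hk⟩ := exists_eq_ciSup_of_finite (f := fun l => A.mulVec y l / A.mulVec x l)
  obtain ⟨p, hp⟩ := exists_eq_ciSup_of_finite (f := fun l => x l / y l)
  obtain ⟨r, hr⟩ := exists_eq_ciSup_of_finite (f := fun l => y l / x l)
  have hple : ∀ l, x l / y l ≤ x p / y p := fun l =>
    (le_ciSup (Set.finite_range fun l => x l / y l).bddAbove l).trans_eq hp.symm
  have hrle : ∀ l, y l / x l ≤ y r / x r := fun l =>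
    (le_ciSup (Set.finite_range fun l => y l / x l).bddAbove l).trans_eq hr.symm
  have ha : ∀ j, x r / y r * y j ≤ x j := by
    intro j
    have h := hrle j
    rw [div_le_div_iff₀ (hx j) (hx r)] at h
    rw [div_mul_eq_mul_div, div_le_iff₀ (hy r)]
    linarith
  have hqi : 0 < A.mulVec x i / A.mulVec y i := div_pos (hAx i) (hAy i)
  have hqk : 0 < A.mulVec x k / A.mulVec y k := div_pos (hAx k) (hAy k)
  have hxp : 0 < x p / y p := div_pos (hx p) (hy p)
  have hxr : 0 < x r / y r := div_pos (hx r) (hy r)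
  have hqi_le : A.mulVec x i / A.mulVec y i ≤ x p / y p := by
    rw [div_le_iff₀ (hAy i)]
    simp only [Matrix.mulVec, dotProduct, Finset.mul_sum]
    refine Finset.sum_le_sum fun j _ => ?_
    have h := (div_le_iff₀ (hy j)).1 (hple j)
    have := mul_le_mul_of_nonneg_left h (zero_le_one.trans (hA i j).1)
    linarith
  have hlog_concave := strictConcaveOn_log_Ioi.concaveOn.2 hqi hxr hδ0.le
    (sub_nonneg.2 hδ1) (by ring)
  simp only [smul_eq_mul] at hlog_concave
  have hlog_k := hlog_concave.trans (Real.log_le_log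
    (add_pos_of_pos_of_nonneg (mul_pos hδ0 hqi) (mul_nonneg (sub_nonneg.2 hδ1) hxr.le))
    (convex_comb_le_mulVec_div hC hA hy ha i k))
  have hlog_i := mul_le_mul_of_nonneg_left (Real.log_le_log hqi hqi_le) (sub_nonneg.2 hδ1)
  unfold hilbertDist
  rw [← hi, ← hk, ← hp, ← hr, ← inv_div (A.mulVec x k), ← inv_div (x r),
    Real.log_mul hqi.ne' (inv_pos.2 hqk).ne', Real.log_mul hxp.ne' (inv_pos.2 hxr).ne',
    Real.log_inv, Real.log_inv]
  linarith
end
end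

section
/- Let N ≥ 1, let C ≥ 1 be a real number, and let (A n)_{n ∈ ℕ} be a sequence of N×N real matrices all of whose entries lie in [1, C]. Define the partial products P 0 := 1 (identity matrix) and P (n+1) := P n * A n, and let K n := (fun x => (P n).mulVec x) '' {x : Fin N → ℝ | ∀ i, 0 ≤ x i}. Then the sets K n are decreasing (K (n+1) ⊆ K n), and there exists a vector v : Fin N → ℝ with all coordinates nonnegative and v ≠ 0 such that ⋂_{n} K n = {t • v | t : ℝ, 0 ≤ t}; i.e., the nested images of the nonnegative orthant intersect in a single half-line. (This is the key step showing unique ergodicity when the homology matrices of the tower system are uniformly bounded.) -/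
noncomputable section

/-- A matrix with entries in `[1, C]` maps a nonnegative vector to one whose coordinates
lie between its coordinate sum and `C` times that sum. -/
lemma mulVec_mem_Icc_sum {N : ℕ} {C : ℝ} {B : Matrix (Fin N) (Fin N) ℝ}
    (hB : ∀ i j, B i j ∈ Set.Icc (1 : ℝ) C) {x : Fin N → ℝ} (hx : ∀ i, 0 ≤ x i) (i : Fin N) :
    B.mulVec x i ∈ Set.Icc (∑ j, x j) (C * ∑ j, x j) := by
  simp only [Matrix.mulVec, dotProduct, Set.mem_Icc, Finset.mul_sum]
  constructor <;> refine Finset.sum_le_sum fun j _ => ?_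
  · exact le_mul_of_one_le_left (hx j) (hB i j).1
  · exact mul_le_mul_of_nonneg_right (hB i j).2 (hx j)

lemma mulVec_nonneg_of_nonneg {N : ℕ} {M : Matrix (Fin N) (Fin N) ℝ}
    (hM : ∀ i j, 0 ≤ M i j) {x : Fin N → ℝ} (hx : ∀ i, 0 ≤ x i) (i : Fin N) :
    0 ≤ M.mulVec x i := by
  simp only [Matrix.mulVec, dotProduct]
  exact Finset.sum_nonneg fun j _ => mul_nonneg (hM i j) (hx j)

lemma mulVec_le_mulVec_of_nonneg {N : ℕ} {M : Matrix (Fin N) (Fin N) ℝ}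
    (hM : ∀ i j, 0 ≤ M i j) {x y : Fin N → ℝ} (hxy : ∀ i, x i ≤ y i) (i : Fin N) :
    M.mulVec x i ≤ M.mulVec y i := by
  simp only [Matrix.mulVec, dotProduct]
  exact Finset.sum_le_sum fun j _ => mul_le_mul_of_nonneg_left (hxy j) (hM i j)

/-- If `u` and `w` lie in the image of the orthant under `M * B`, where `M` is nonnegative and
`B` has entries in `[1, C]`, then a definite multiple of `w` may be subtracted from `u`
without leaving the image of the orthant under `M`. -/
lemma exists_nonneg_mulVec_eq_sub_smul {N : ℕ} {C : ℝ} (hC : 1 ≤ C)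
    {M B : Matrix (Fin N) (Fin N) ℝ} (hM : ∀ i j, 0 ≤ M i j)
    (hB : ∀ i j, B i j ∈ Set.Icc (1 : ℝ) C) {x y : Fin N → ℝ}
    (hx : ∀ i, 0 ≤ x i) (hy : ∀ i, 0 ≤ y i) {i : Fin N}
    (hi : 0 < (M * B).mulVec y i) :
    ∃ z : Fin N → ℝ, (∀ j, 0 ≤ z j) ∧ M.mulVec z =
      (M * B).mulVec x -
        ((C ^ 2)⁻¹ * ((M * B).mulVec x i / (M * B).mulVec y i)) • (M * B).mulVec y := by
  have hC0 : 0 < C := by linarith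
  simp only [← Matrix.mulVec_mulVec] at hi ⊢
  set m := M.mulVec 1 i with hm
  set X := ∑ j, x j with hX
  set Y := ∑ j, y j with hY
  have hX0 : 0 ≤ X := Finset.sum_nonneg fun j _ => hx j
  have hY0 : 0 ≤ Y := Finset.sum_nonneg fun j _ => hy j
  have hconst (a : ℝ) : M.mulVec (a • 1) i = a * m := by
    rw [Matrix.mulVec_smul]; rfl
  have hu : M.mulVec (B.mulVec x) i ≤ C * X * m := by
    rw [← hconst]
    exact mulVec_le_mulVec_of_nonneg hM
      (fun j => by simpa using (mulVec_mem_Icc_sum hB hx j).2) i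
  have hw : Y * m ≤ M.mulVec (B.mulVec y) i := by
    rw [← hconst]
    exact mulVec_le_mulVec_of_nonneg hM
      (fun j => by simpa using (mulVec_mem_Icc_sum hB hy j).1) i
  have hw' : M.mulVec (B.mulVec y) i ≤ C * Y * m := by
    rw [← hconst]
    exact mulVec_le_mulVec_of_nonneg hM
      (fun j => by simpa using (mulVec_mem_Icc_sum hB hy j).2) i
  have hu0 : 0 ≤ M.mulVec (B.mulVec x) i :=
    mulVec_nonneg_of_nonneg hM
      (fun j => hX0.trans (mulVec_mem_Icc_sum hB hx j).1) i
  have hm0 : 0 < m := by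
    by_contra! h
    have : C * Y * m ≤ 0 := mul_nonpos_of_nonneg_of_nonpos (by positivity) h
    linarith
  set a := M.mulVec (B.mulVec x) i
  set b := M.mulVec (B.mulVec y) i
  set c := (C ^ 2)⁻¹ * (a / b) with hc
  have hc0 : 0 ≤ c := by positivity
  have hcb : c * b * C ^ 2 = a := by rw [hc]; field_simp
  have hcY : c * (C * Y) ≤ X := by
    have h1 : c * (Y * m) ≤ c * b := mul_le_mul_of_nonneg_left hw hc0
    have h2 : (C * m) * (c * (C * Y)) ≤ (C * m) * X := by
      have := mul_le_mul_of_nonneg_right h1 (sq_nonneg C)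
      linarith
    exact le_of_mul_le_mul_left h2 (by positivity)
  refine ⟨B.mulVec x - c • B.mulVec y, fun j => ?_, by
    rw [Matrix.mulVec_sub, Matrix.mulVec_smul]⟩
  have h1 := (mulVec_mem_Icc_sum hB hx j).1
  have h2 := mul_le_mul_of_nonneg_left (mulVec_mem_Icc_sum hB hy j).2 hc0
  simp only [Pi.sub_apply, Pi.smul_apply, smul_eq_mul]
  linarith

/-- In a set `S` of nonnegative vectors which is stable under subtracting a fixed proportion `δ`
of the multiple of `w` that would annihilate a coordinate, every element is a multiple of the
positive vector `w`. -/
lemma eq_smul_of_sub_smul_mem {N : ℕ} {S : Set (Fin N → ℝ)} {δ : ℝ} (hδ0 : 0 < δ)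
    (hδ1 : δ ≤ 1) (hS : ∀ u ∈ S, ∀ i, 0 ≤ u i) {w : Fin N → ℝ} (hw : ∀ i, 0 < w i)
    (hsub : ∀ u ∈ S, ∀ i, u - (δ * (u i / w i)) • w ∈ S) {u : Fin N → ℝ} (hu : u ∈ S)
    (i : Fin N) : u = (u i / w i) • w := by
  have hmem (i : Fin N) (k : ℕ) : u - ((1 - (1 - δ) ^ k) * (u i / w i)) • w ∈ S := by
    induction k with
    | zero => simpa using hu
    | succ k ih =>
      convert hsub _ ih i using 1
      ext j
      have := (hw i).ne'
      simp only [Pi.sub_apply, Pi.smul_apply, smul_eq_mul]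
      field_simp
      ring
  have hle (i j : Fin N) : u i / w i * w j ≤ u j := by
    have hlim : Filter.Tendsto (fun k : ℕ => (1 - (1 - δ) ^ k) * (u i / w i) * w j)
        Filter.atTop (nhds ((1 - 0) * (u i / w i) * w j)) :=
      ((tendsto_const_nhds.sub (tendsto_pow_atTop_nhds_zero_of_lt_one
        (by linarith) (by linarith))).mul_const _).mul_const _
    rw [sub_zero, one_mul] at hlim
    refine le_of_tendsto' hlim fun k => ?_
    simpa using hS _ (hmem i k) j
  ext j
  refine le_antisymm ?_ (hle i j)
  have h := hle j i
  have hi := hw i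
  have hj := hw j
  simp only [Pi.smul_apply, smul_eq_mul]
  rw [div_mul_eq_mul_div, div_le_iff₀ hj] at h
  rw [div_mul_eq_mul_div, le_div_iff₀ hi]
  exact h

/-- The slice of the image of the orthant under a matrix with entries at least `1` by the
hyperplane of vectors with coordinate sum `1` is compact. -/
lemma isCompact_image_orthant_inter_sum_eq_one {N : ℕ} {M : Matrix (Fin N) (Fin N) ℝ}
    (hM : ∀ i j, 1 ≤ M i j) :
    IsCompact ((fun x => M.mulVec x) '' {x : Fin N → ℝ | ∀ i, 0 ≤ x i} ∩
      {w | ∑ i, w i = 1}) := by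
  have hcont : Continuous fun x : Fin N → ℝ => M.mulVec x :=
    Continuous.matrix_mulVec continuous_const continuous_id
  rw [← Set.image_inter_preimage]
  refine IsCompact.image ?_ hcont
  refine (isCompact_Icc (a := (0 : Fin N → ℝ)) (b := 1)).of_isClosed_subset ?_ ?_
  · refine IsClosed.inter ?_ ?_
    · simp only [Set.ofPred_forall]
      exact isClosed_iInter fun i => isClosed_le continuous_const (continuous_apply i)
    · exact (isClosed_eq (continuous_finsetSum _ fun i _ => continuous_apply i)
        continuous_const).preimage hcont
  · rintro x ⟨hx, hsum⟩
    have hx' : ∀ i, 0 ≤ x i := hx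
    have hsum' : ∑ i, M.mulVec x i = 1 := hsum
    refine ⟨hx, fun j => ?_⟩
    have hM0 : ∀ i j, 0 ≤ M i j := fun i j => zero_le_one.trans (hM i j)
    calc x j ≤ M j j * x j := le_mul_of_one_le_left (hx' j) (hM j j)
      _ ≤ M.mulVec x j := Finset.single_le_sum (f := fun k => M j k * x k)
          (fun k _ => mul_nonneg (hM0 j k) (hx' k)) (Finset.mem_univ j)
      _ ≤ ∑ i, M.mulVec x i := Finset.single_le_sum
          (fun k _ => mulVec_nonneg_of_nonneg hM0 hx' k) (Finset.mem_univ j)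
      _ = 1 := hsum'

/-- The image of the orthant under a matrix with entries at least `1` contains a vector with
coordinate sum `1`. -/
lemma nonempty_image_orthant_inter_sum_eq_one {N : ℕ} (hN : 1 ≤ N)
    {M : Matrix (Fin N) (Fin N) ℝ} (hM : ∀ i j, 1 ≤ M i j) :
    ((fun x => M.mulVec x) '' {x : Fin N → ℝ | ∀ i, 0 ≤ x i} ∩
      {w | ∑ i, w i = 1}).Nonempty := by
  have : Nonempty (Fin N) := ⟨⟨0, hN⟩⟩
  have hpos : 0 < ∑ i, M.mulVec 1 i := by
    refine Finset.sum_pos (fun i _ => ?_) Finset.univ_nonempty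
    simp only [Matrix.mulVec, dotProduct]
    refine Finset.sum_pos (fun j _ => ?_) Finset.univ_nonempty
    simpa using zero_lt_one.trans_le (hM i j)
  refine ⟨_, ⟨(∑ i, M.mulVec 1 i)⁻¹ • 1, fun i => ?_, rfl⟩, ?_⟩
  · simpa using hpos.le
  · simp only [Set.mem_ofPred_eq, Matrix.mulVec_smul, Pi.smul_apply, smul_eq_mul,
      ← Finset.mul_sum]
    exact inv_mul_cancel₀ hpos.ne'

/-- Let `(A n)` be a sequence of `N × N` matrices with all entries in
`[1, C]`, `P n` the partial products (`P 0 = 1`, `P (n+1) = P n * A n`), and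
`K n = P n '' (nonnegative orthant)`.  Then the `K n` are decreasing and their intersection
is a single half-line `{t • v | 0 ≤ t}` for some nonzero nonnegative vector `v`. -/
theorem nested_images_of_orthant_eq_halfLine
    (N : ℕ) (hN : 1 ≤ N) (C : ℝ) (hC : 1 ≤ C)
    (A : ℕ → Matrix (Fin N) (Fin N) ℝ)
    (hA : ∀ n i j, (A n) i j ∈ Set.Icc (1 : ℝ) C)
    (P : ℕ → Matrix (Fin N) (Fin N) ℝ)
    (hP0 : P 0 = 1) (hPsucc : ∀ n, P (n + 1) = P n * A n)
    (K : ℕ → Set (Fin N → ℝ))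
    (hK : ∀ n, K n = (fun x => (P n).mulVec x) '' {x : Fin N → ℝ | ∀ i, 0 ≤ x i}) :
    (∀ n, K (n + 1) ⊆ K n) ∧
      ∃ v : Fin N → ℝ, (∀ i, 0 ≤ v i) ∧ v ≠ 0 ∧
        (⋂ n, K n) = {w : Fin N → ℝ | ∃ t : ℝ, 0 ≤ t ∧ w = t • v} := by
  have hC0 : 0 < C := by linarith
  have i₀ : Fin N := ⟨0, hN⟩
  have hP1 (n : ℕ) : ∀ i j, 1 ≤ P (n + 1) i j := by
    induction n with
    | zero => intro i j; simpa [hPsucc, hP0] using (hA 0 i j).1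
    | succ n ih =>
      intro i j
      rw [hPsucc, Matrix.mul_apply]
      have h (k : Fin N) : 1 ≤ P (n + 1) i k * A (n + 1) k j :=
        one_le_mul_of_one_le_of_one_le (ih i k) (hA (n + 1) k j).1
      exact (h i₀).trans (Finset.single_le_sum
        (f := fun k => P (n + 1) i k * A (n + 1) k j)
        (fun k _ => zero_le_one.trans (h k)) (Finset.mem_univ i₀))
  have hPnonneg (n : ℕ) : ∀ i j, 0 ≤ P n i j := by
    intro i j
    cases n with
    | zero => rw [hP0, Matrix.one_apply]; split_ifs <;> norm_num
    | succ n => exact zero_le_one.trans (hP1 n i j)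
  have hanti (n : ℕ) : K (n + 1) ⊆ K n := by
    rw [hK, hK]
    rintro _ ⟨x, hx, rfl⟩
    refine ⟨(A n).mulVec x, mulVec_nonneg_of_nonneg
      (fun i j => zero_le_one.trans (hA n i j).1) hx, ?_⟩
    simp only [hPsucc, Matrix.mulVec_mulVec]
  refine ⟨hanti, ?_⟩
  obtain ⟨v, hv⟩ : (⋂ n, K (n + 1) ∩ {w | ∑ i, w i = 1}).Nonempty := by
    refine IsCompact.nonempty_iInter_of_sequence_nonempty_isCompact_isClosed _
      (fun n => Set.inter_subset_inter_left _ (hanti _)) (fun n => ?_) ?_ (fun n => ?_)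
    · rw [hK]; exact nonempty_image_orthant_inter_sum_eq_one hN (hP1 n)
    · rw [hK]; exact isCompact_image_orthant_inter_sum_eq_one (hP1 0)
    · rw [hK]; exact (isCompact_image_orthant_inter_sum_eq_one (hP1 n)).isClosed
  rw [Set.mem_iInter] at hv
  have hvK (n : ℕ) : v ∈ K n := hanti n (hv n).1
  have hvsum : ∑ i, v i = 1 := (hv 0).2
  have hv0 : v ≠ 0 := by rintro rfl; simp at hvsum
  have hvpos : ∀ i, 0 < v i := by
    have h := hvK 1
    rw [hK] at h
    obtain ⟨x, hx, rfl⟩ := h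
    intro i
    have hx' : ∀ j, 0 ≤ x j := hx
    rw [hPsucc, hP0, one_mul] at hv0 ⊢
    refine lt_of_lt_of_le ?_ (mulVec_mem_Icc_sum (hA 0) hx i).1
    refine lt_of_le_of_ne (Finset.sum_nonneg fun j _ => hx' j) fun h => hv0 ?_
    have : x = 0 := funext fun j =>
      (Finset.sum_eq_zero_iff_of_nonneg fun j _ => hx' j).1 h.symm j (Finset.mem_univ j)
    simp [this]
  have hnonneg : ∀ u ∈ ⋂ n, K n, ∀ i, 0 ≤ u i := by
    intro u hu
    have h := Set.mem_iInter.1 hu 0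
    rw [hK] at h
    obtain ⟨x, hx, rfl⟩ := h
    exact mulVec_nonneg_of_nonneg (hPnonneg 0) hx
  have hsub : ∀ u ∈ ⋂ n, K n, ∀ i, u - ((C ^ 2)⁻¹ * (u i / v i)) • v ∈ ⋂ n, K n := by
    intro u hu i
    refine Set.mem_iInter.2 fun n => ?_
    have h1 := Set.mem_iInter.1 hu (n + 1)
    have h2 := hvK (n + 1)
    have hi := hvpos i
    rw [hK, hPsucc] at h1 h2
    obtain ⟨x, hx, rfl⟩ := h1
    obtain ⟨y, hy, rfl⟩ := h2
    obtain ⟨z, hz, h⟩ := exists_nonneg_mulVec_eq_sub_smul hC (hPnonneg n) (hA n) hx hy hi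
    rw [hK]
    exact ⟨z, hz, h⟩
  refine ⟨v, fun i => (hvpos i).le, hv0, Set.Subset.antisymm (fun u hu => ?_) ?_⟩
  · exact ⟨u i₀ / v i₀, div_nonneg (hnonneg u hu i₀) (hvpos i₀).le,
      eq_smul_of_sub_smul_mem (by positivity) (inv_le_one_of_one_le₀ (one_le_pow₀ hC))
        hnonneg hvpos hsub hu i₀⟩
  · rintro _ ⟨t, ht, rfl⟩
    refine Set.mem_iInter.2 fun n => ?_
    have h := hvK n
    rw [hK] at h ⊢
    obtain ⟨x, hx, hxv⟩ := h
    refine ⟨t • x, fun i => mul_nonneg ht (hx i), ?_⟩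
    simp only [Matrix.mulVec_smul]
    exact congrArg (t • ·) hxv
end
end
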